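/- arXiv:math/0507506 — 3 statements merged into one kernel-verified Lean document; each statement's English description precedes it below -/
import Mathlib

section
/- For all α, β ∈ π: (1) Δ_{β⁻¹,α⁻¹} ∘ S_{αβ} = σ ∘ (S_α ⊗ S_β) ∘ Δ_{α,β}, where σ: A_{α⁻¹} ⊗ A_{β⁻¹} → A_{β⁻¹} ⊗ A_{α⁻¹} is the flip map x ⊗ y ↦ y ⊗ x; (2) ε ∘ S₁ = ε; (3) S_α(ab) = S_α(b) S_α(a) for all a, b ∈ A_α; (4) S_α(1_α) = 1_{α⁻¹}. -/
open TensorProduct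

namespace HopfGroupCoalgebra

section Convolution

variable {k : Type*} [CommRing k]
  {U V W X Y Z E B B' : Type*}
  [AddCommGroup U] [Module k U] [AddCommGroup V] [Module k V] [AddCommGroup W] [Module k W]
  [AddCommGroup X] [Module k X] [AddCommGroup Y] [Module k Y] [AddCommGroup Z] [Module k Z]
  [AddCommGroup E] [Module k E]
  [Ring B] [Algebra k B] [Ring B'] [Algebra k B']

/-- The convolution of `f : X → B` and `g : Y → B` along `Δ : Z → X ⊗ Y`. -/
def conv (Δ : Z →ₗ[k] X ⊗[k] Y) (f : X →ₗ[k] B) (g : Y →ₗ[k] B) : Z →ₗ[k] B :=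
  LinearMap.mul' k B ∘ₗ TensorProduct.map f g ∘ₗ Δ

/-- The map `x ↦ ε x • 1`, the unit for convolution. -/
def convUnit (B : Type*) [Ring B] [Algebra k B] (ε : E →ₗ[k] k) : E →ₗ[k] B :=
  Algebra.linearMap k B ∘ₗ ε

theorem convUnit_apply (ε : E →ₗ[k] k) (x : E) : convUnit B ε x = ε x • 1 := by
  simp [convUnit, Algebra.algebraMap_eq_smul_one]

theorem conv_assoc {Δ₁ : W →ₗ[k] U ⊗[k] Z} {Δ₂ : U →ₗ[k] X ⊗[k] Y}
    {Δ₃ : W →ₗ[k] X ⊗[k] V} {Δ₄ : V →ₗ[k] Y ⊗[k] Z}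
    (h : (TensorProduct.assoc k X Y Z).toLinearMap ∘ₗ LinearMap.rTensor Z Δ₂ ∘ₗ Δ₁
      = LinearMap.lTensor X Δ₄ ∘ₗ Δ₃)
    (f : X →ₗ[k] B) (g : Y →ₗ[k] B) (l : Z →ₗ[k] B) :
    conv Δ₁ (conv Δ₂ f g) l = conv Δ₃ f (conv Δ₄ g l) := by
  let T : X ⊗[k] (Y ⊗[k] Z) →ₗ[k] B :=
    LinearMap.mul' k B ∘ₗ TensorProduct.map f (LinearMap.mul' k B ∘ₗ TensorProduct.map g l)
  have hl : conv Δ₁ (conv Δ₂ f g) l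
      = T ∘ₗ ((TensorProduct.assoc k X Y Z).toLinearMap ∘ₗ LinearMap.rTensor Z Δ₂ ∘ₗ Δ₁) := by
    have : LinearMap.mul' k B ∘ₗ TensorProduct.map (conv Δ₂ f g) l
        = T ∘ₗ (TensorProduct.assoc k X Y Z).toLinearMap ∘ₗ LinearMap.rTensor Z Δ₂ := by
      refine TensorProduct.ext' fun u z => ?_
      simp only [conv, T, LinearMap.comp_apply, TensorProduct.map_tmul, LinearMap.rTensor_tmul,
        LinearMap.mul'_apply, LinearEquiv.coe_coe]
      induction Δ₂ u with
      | zero => simp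
      | tmul x y => simp [mul_assoc]
      | add p q hp hq => simp only [map_add, add_mul, add_tmul, hp, hq]
    exact congrArg (· ∘ₗ Δ₁) this
  have hr : conv Δ₃ f (conv Δ₄ g l) = T ∘ₗ (LinearMap.lTensor X Δ₄ ∘ₗ Δ₃) := by
    have : LinearMap.mul' k B ∘ₗ TensorProduct.map f (conv Δ₄ g l)
        = T ∘ₗ LinearMap.lTensor X Δ₄ :=
      TensorProduct.ext' fun x v => by simp [conv, T]
    exact congrArg (· ∘ₗ Δ₃) this
  rw [hl, hr, h]

theorem conv_convUnit {Δ : Z →ₗ[k] X ⊗[k] E} {ε : E →ₗ[k] k} {i : Z →ₗ[k] X}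
    (h : (TensorProduct.rid k X).toLinearMap ∘ₗ LinearMap.lTensor X ε ∘ₗ Δ = i)
    (f : X →ₗ[k] B) : conv Δ f (convUnit B ε) = f ∘ₗ i := by
  have : LinearMap.mul' k B ∘ₗ TensorProduct.map f (convUnit B ε)
      = f ∘ₗ (TensorProduct.rid k X).toLinearMap ∘ₗ LinearMap.lTensor X ε :=
    TensorProduct.ext' fun x e => by simp [convUnit_apply]
  rw [← h]
  exact congrArg (· ∘ₗ Δ) this

theorem convUnit_conv {Δ : Z →ₗ[k] E ⊗[k] X} {ε : E →ₗ[k] k} {i : Z →ₗ[k] X}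
    (h : (TensorProduct.lid k X).toLinearMap ∘ₗ LinearMap.rTensor X ε ∘ₗ Δ = i)
    (f : X →ₗ[k] B) : conv Δ (convUnit B ε) f = f ∘ₗ i := by
  have : LinearMap.mul' k B ∘ₗ TensorProduct.map (convUnit B ε) f
      = f ∘ₗ (TensorProduct.lid k X).toLinearMap ∘ₗ LinearMap.rTensor X ε :=
    TensorProduct.ext' fun e x => by simp [convUnit_apply]
  rw [← h]
  exact congrArg (· ∘ₗ Δ) this

theorem comp_conv (φ : B →ₐ[k] B') (Δ : Z →ₗ[k] X ⊗[k] Y) (f : X →ₗ[k] B) (g : Y →ₗ[k] B) :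
    φ.toLinearMap ∘ₗ conv Δ f g = conv Δ (φ.toLinearMap ∘ₗ f) (φ.toLinearMap ∘ₗ g) := by
  have : φ.toLinearMap ∘ₗ LinearMap.mul' k B ∘ₗ TensorProduct.map f g
      = LinearMap.mul' k B' ∘ₗ
        TensorProduct.map (φ.toLinearMap ∘ₗ f) (φ.toLinearMap ∘ₗ g) :=
    TensorProduct.ext' fun x y => by simp
  exact congrArg (· ∘ₗ Δ) this

theorem comp_convUnit (φ : B →ₐ[k] B') (ε : E →ₗ[k] k) :
    φ.toLinearMap ∘ₗ convUnit B ε = convUnit B' ε := by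
  ext x
  simp [convUnit_apply]

/-- A left and a right convolution inverse of the same map agree. -/
theorem left_inverse_eq_right_inverse {Δ₁ : X →ₗ[k] E ⊗[k] X} {Δ₂ : E →ₗ[k] X ⊗[k] Y}
    {Δ₃ : X →ₗ[k] X ⊗[k] E} {Δ₄ : E →ₗ[k] Y ⊗[k] X} {ε : E →ₗ[k] k}
    (h : (TensorProduct.assoc k X Y X).toLinearMap ∘ₗ LinearMap.rTensor X Δ₂ ∘ₗ Δ₁
      = LinearMap.lTensor X Δ₄ ∘ₗ Δ₃)
    (h₁ : (TensorProduct.lid k X).toLinearMap ∘ₗ LinearMap.rTensor X ε ∘ₗ Δ₁ = LinearMap.id)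
    (h₃ : (TensorProduct.rid k X).toLinearMap ∘ₗ LinearMap.lTensor X ε ∘ₗ Δ₃ = LinearMap.id)
    {f g : X →ₗ[k] B} {m : Y →ₗ[k] B}
    (hf : conv Δ₂ f m = convUnit B ε) (hg : conv Δ₄ m g = convUnit B ε) : f = g := by
  have := conv_assoc h f m g
  rw [hf, hg, convUnit_conv h₁, conv_convUnit h₃] at this
  exact this.symm

/-- The comultiplication on the tensor square induced by `Δ : Z → X ⊗ Y`. -/
def squareComul (Δ : Z →ₗ[k] X ⊗[k] Y) : Z ⊗[k] Z →ₗ[k] (X ⊗[k] X) ⊗[k] (Y ⊗[k] Y) :=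
  (TensorProduct.tensorTensorTensorComm k X Y X Y).toLinearMap ∘ₗ TensorProduct.map Δ Δ

/-- The counit on the tensor square induced by `ε`. -/
def squareCounit (ε : E →ₗ[k] k) : E ⊗[k] E →ₗ[k] k :=
  LinearMap.mul' k k ∘ₗ TensorProduct.map ε ε

theorem squareComul_coassoc {Δ₁ : W →ₗ[k] U ⊗[k] Z} {Δ₂ : U →ₗ[k] X ⊗[k] Y}
    {Δ₃ : W →ₗ[k] X ⊗[k] V} {Δ₄ : V →ₗ[k] Y ⊗[k] Z}
    (h : (TensorProduct.assoc k X Y Z).toLinearMap ∘ₗ LinearMap.rTensor Z Δ₂ ∘ₗ Δ₁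
      = LinearMap.lTensor X Δ₄ ∘ₗ Δ₃) :
    (TensorProduct.assoc k (X ⊗[k] X) (Y ⊗[k] Y) (Z ⊗[k] Z)).toLinearMap ∘ₗ
        LinearMap.rTensor (Z ⊗[k] Z) (squareComul Δ₂) ∘ₗ squareComul Δ₁
      = LinearMap.lTensor (X ⊗[k] X) (squareComul Δ₄) ∘ₗ squareComul Δ₃ := by
  let T := LinearMap.lTensor (X ⊗[k] X)
      (TensorProduct.tensorTensorTensorComm k Y Z Y Z).toLinearMap ∘ₗ
    (TensorProduct.tensorTensorTensorComm k X (Y ⊗[k] Z) X (Y ⊗[k] Z)).toLinearMap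
  have hl (u u' : U) (z z' : Z) :
      TensorProduct.assoc k (X ⊗[k] X) (Y ⊗[k] Y) (Z ⊗[k] Z)
        (LinearMap.rTensor (Z ⊗[k] Z) (squareComul Δ₂) ((u ⊗ₜ u') ⊗ₜ (z ⊗ₜ z')))
      = T (TensorProduct.assoc k X Y Z (LinearMap.rTensor Z Δ₂ (u ⊗ₜ z)) ⊗ₜ
          TensorProduct.assoc k X Y Z (LinearMap.rTensor Z Δ₂ (u' ⊗ₜ z'))) := by
    simp only [squareComul, T, LinearMap.rTensor_tmul, LinearMap.comp_apply,
      TensorProduct.map_tmul, LinearEquiv.coe_coe]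
    induction Δ₂ u with
    | zero => simp
    | add p q hp hq => simp only [map_add, add_tmul, hp, hq]
    | tmul x y =>
      induction Δ₂ u' with
      | zero => simp
      | add p q hp hq => simp only [map_add, add_tmul, tmul_add, hp, hq]
      | tmul x' y' => simp
  have hl' (p q : U ⊗[k] Z) :
      TensorProduct.assoc k (X ⊗[k] X) (Y ⊗[k] Y) (Z ⊗[k] Z)
        (LinearMap.rTensor (Z ⊗[k] Z) (squareComul Δ₂)
          (TensorProduct.tensorTensorTensorComm k U Z U Z (p ⊗ₜ q)))
      = T (TensorProduct.assoc k X Y Z (LinearMap.rTensor Z Δ₂ p) ⊗ₜ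
          TensorProduct.assoc k X Y Z (LinearMap.rTensor Z Δ₂ q)) := by
    induction p with
    | zero => simp
    | add p p' hp hp' => simp only [map_add, add_tmul, hp, hp']
    | tmul u z =>
      induction q with
      | zero => simp
      | add q q' hq hq' => simp only [map_add, tmul_add, hq, hq']
      | tmul u' z' => rw [TensorProduct.tensorTensorTensorComm_tmul, hl]
  have hr (p q : X ⊗[k] V) :
      LinearMap.lTensor (X ⊗[k] X) (squareComul Δ₄)
          (TensorProduct.tensorTensorTensorComm k X V X V (p ⊗ₜ q))
      = T (LinearMap.lTensor X Δ₄ p ⊗ₜ LinearMap.lTensor X Δ₄ q) := by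
    induction p with
    | zero => simp
    | add p p' hp hp' => simp only [map_add, add_tmul, hp, hp']
    | tmul x v =>
      induction q with
      | zero => simp
      | add q q' hq hq' => simp only [map_add, tmul_add, hq, hq']
      | tmul x' v' => simp [squareComul, T]
  refine TensorProduct.ext' fun w w' => ?_
  have hw := LinearMap.congr_fun h
  simp only [LinearMap.comp_apply, LinearEquiv.coe_coe] at hw
  have h₁ := hl' (Δ₁ w) (Δ₁ w')
  rw [hw, hw, ← hr] at h₁
  exact h₁

theorem squareCounit_rid {Δ : X →ₗ[k] X ⊗[k] E} {ε : E →ₗ[k] k}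
    (h : (TensorProduct.rid k X).toLinearMap ∘ₗ LinearMap.lTensor X ε ∘ₗ Δ = LinearMap.id) :
    (TensorProduct.rid k (X ⊗[k] X)).toLinearMap ∘ₗ
      LinearMap.lTensor (X ⊗[k] X) (squareCounit ε) ∘ₗ squareComul Δ = LinearMap.id := by
  have key : (TensorProduct.rid k (X ⊗[k] X)).toLinearMap ∘ₗ
        LinearMap.lTensor (X ⊗[k] X) (squareCounit ε) ∘ₗ
        (TensorProduct.tensorTensorTensorComm k X E X E).toLinearMap
      = TensorProduct.map ((TensorProduct.rid k X).toLinearMap ∘ₗ LinearMap.lTensor X ε)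
          ((TensorProduct.rid k X).toLinearMap ∘ₗ LinearMap.lTensor X ε) := by
    ext x e x' e'
    simp [squareCounit, smul_tmul', smul_smul, mul_comm]
  have := congrArg (· ∘ₗ TensorProduct.map Δ Δ) key
  simp only [← TensorProduct.map_comp, LinearMap.comp_assoc, h, TensorProduct.map_id] at this
  exact this

theorem squareCounit_lid {Δ : X →ₗ[k] E ⊗[k] X} {ε : E →ₗ[k] k}
    (h : (TensorProduct.lid k X).toLinearMap ∘ₗ LinearMap.rTensor X ε ∘ₗ Δ = LinearMap.id) :
    (TensorProduct.lid k (X ⊗[k] X)).toLinearMap ∘ₗ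
      LinearMap.rTensor (X ⊗[k] X) (squareCounit ε) ∘ₗ squareComul Δ = LinearMap.id := by
  have key : (TensorProduct.lid k (X ⊗[k] X)).toLinearMap ∘ₗ
        LinearMap.rTensor (X ⊗[k] X) (squareCounit ε) ∘ₗ
        (TensorProduct.tensorTensorTensorComm k E X E X).toLinearMap
      = TensorProduct.map ((TensorProduct.lid k X).toLinearMap ∘ₗ LinearMap.rTensor X ε)
          ((TensorProduct.lid k X).toLinearMap ∘ₗ LinearMap.rTensor X ε) := by
    ext e x e' x'
    simp [squareCounit, smul_tmul', smul_smul, mul_comm]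
  have := congrArg (· ∘ₗ TensorProduct.map Δ Δ) key
  simp only [← TensorProduct.map_comp, LinearMap.comp_assoc, h, TensorProduct.map_id] at this
  exact this

end Convolution

section Antipode

variable {k : Type*} [CommRing k] {P Q R : Type*} [Ring P] [Algebra k P] [Ring Q] [Algebra k Q]
  [Ring R] [Algebra k R]

/-- If `S` is a left convolution inverse of the identity, then `S ∘ mul` is one of `mul`. -/
theorem conv_comp_mul {Δ : R →ₐ[k] P ⊗[k] Q} {ε : R →ₐ[k] k} {S : P →ₗ[k] Q}
    (h : conv Δ.toLinearMap S LinearMap.id = convUnit Q ε.toLinearMap) :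
    conv (squareComul Δ.toLinearMap) (S ∘ₗ LinearMap.mul' k P) (LinearMap.mul' k Q)
      = convUnit Q (squareCounit ε.toLinearMap) := by
  have key (u v : P ⊗[k] Q) :
      LinearMap.mul' k Q (TensorProduct.map (S ∘ₗ LinearMap.mul' k P) (LinearMap.mul' k Q)
        (TensorProduct.tensorTensorTensorComm k P Q P Q (u ⊗ₜ v)))
      = LinearMap.mul' k Q (TensorProduct.map S LinearMap.id (u * v)) := by
    induction u with
    | zero => simp
    | add p q hp hq => simp only [map_add, add_tmul, add_mul, hp, hq]
    | tmul x y =>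
      induction v with
      | zero => simp
      | add p q hp hq => simp only [map_add, tmul_add, mul_add, hp, hq]
      | tmul x' y' => simp
  refine TensorProduct.ext' fun a b => ?_
  have hab := LinearMap.congr_fun h (a * b)
  refine (key (Δ a) (Δ b)).trans ?_
  rw [← map_mul]
  refine hab.trans ?_
  simp [convUnit_apply, squareCounit]

/-- If `S` is a right convolution inverse of the identity, then `a ⊗ b ↦ S b * S a` is one of
`mul`. -/
theorem conv_mul_comm_map {Δ : R →ₐ[k] P ⊗[k] Q} {ε : R →ₐ[k] k} {S : Q →ₗ[k] P}
    (h : conv Δ.toLinearMap LinearMap.id S = convUnit P ε.toLinearMap) :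
    conv (squareComul Δ.toLinearMap) (LinearMap.mul' k P)
        (LinearMap.mul' k P ∘ₗ (TensorProduct.comm k P P).toLinearMap ∘ₗ TensorProduct.map S S)
      = convUnit P (squareCounit ε.toLinearMap) := by
  have key (x : P) (y : Q) (v : P ⊗[k] Q) :
      LinearMap.mul' k P (TensorProduct.map (LinearMap.mul' k P)
        (LinearMap.mul' k P ∘ₗ (TensorProduct.comm k P P).toLinearMap ∘ₗ TensorProduct.map S S)
        (TensorProduct.tensorTensorTensorComm k P Q P Q ((x ⊗ₜ y) ⊗ₜ v)))
      = x * LinearMap.mul' k P (TensorProduct.map LinearMap.id S v) * S y := by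
    induction v with
    | zero => simp
    | add p q hp hq => simp only [map_add, tmul_add, mul_add, add_mul, hp, hq]
    | tmul x' y' => simp [mul_assoc]
  have h' (x : R) : LinearMap.mul' k P (TensorProduct.map LinearMap.id S (Δ x)) = ε x • 1 :=
    (LinearMap.congr_fun h x).trans (convUnit_apply _ _)
  have key' (b : R) (u : P ⊗[k] Q) :
      LinearMap.mul' k P (TensorProduct.map (LinearMap.mul' k P)
        (LinearMap.mul' k P ∘ₗ (TensorProduct.comm k P P).toLinearMap ∘ₗ TensorProduct.map S S)
        (TensorProduct.tensorTensorTensorComm k P Q P Q (u ⊗ₜ Δ b)))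
      = ε b • LinearMap.mul' k P (TensorProduct.map LinearMap.id S u) := by
    induction u with
    | zero => simp
    | add p q hp hq => simp only [map_add, add_tmul, smul_add, hp, hq]
    | tmul x y => rw [key, h']; simp
  refine TensorProduct.ext' fun a b => ?_
  refine (key' b (Δ a)).trans ?_
  rw [h', convUnit_apply, smul_smul, mul_comm]
  simp [squareCounit]

end Antipode

end HopfGroupCoalgebra

open HopfGroupCoalgebra
/-- Properties of the antipode of a Hopf `π`-coalgebra:
`Δ_{β⁻¹,α⁻¹} ∘ S_{αβ} = σ ∘ (S_α ⊗ S_β) ∘ Δ_{α,β}`, `ε ∘ S₁ = ε`,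
`S_α` is antimultiplicative, and `S_α(1_α) = 1_{α⁻¹}`. -/
theorem hopf_group_coalgebra_antipode_properties
    {k : Type} [Field k] {G : Type} [Group G]
    (A : G → Type) [∀ α, Ring (A α)] [∀ α, Algebra k (A α)]
    (Δ : ∀ α β γ : G, α * β = γ → (A γ →ₐ[k] A α ⊗[k] A β))
    (ε : A 1 →ₐ[k] k)
    (S : ∀ α β : G, α⁻¹ = β → (A α →ₗ[k] A β))
    (hcoassoc : ∀ (α β γ : G) (x : A (α * β * γ)),
      (TensorProduct.assoc k (A α) (A β) (A γ))
          ((Algebra.TensorProduct.map (Δ α β (α * β) rfl) (AlgHom.id k (A γ)))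
            ((Δ (α * β) γ (α * β * γ) rfl) x))
        = (Algebra.TensorProduct.map (AlgHom.id k (A α)) (Δ β γ (β * γ) rfl))
            ((Δ α (β * γ) (α * β * γ) (mul_assoc α β γ).symm) x))
    (hcounit₁ : ∀ (α : G) (x : A α),
      (TensorProduct.rid k (A α)) ((LinearMap.lTensor (A α) ε.toLinearMap)
        ((Δ α 1 α (mul_one α)) x)) = x)
    (hcounit₂ : ∀ (α : G) (x : A α),
      (TensorProduct.lid k (A α)) ((LinearMap.rTensor (A α) ε.toLinearMap)
        ((Δ 1 α α (one_mul α)) x)) = x)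
    (hantipode₁ : ∀ (α : G) (x : A 1),
      (LinearMap.mul' k (A α)) ((LinearMap.rTensor (A α) (S α⁻¹ α (inv_inv α)))
        ((Δ α⁻¹ α 1 (inv_mul_cancel α)) x)) = ε x • 1)
    (hantipode₂ : ∀ (α : G) (x : A 1),
      (LinearMap.mul' k (A α)) ((LinearMap.lTensor (A α) (S α⁻¹ α (inv_inv α)))
        ((Δ α α⁻¹ 1 (mul_inv_cancel α)) x)) = ε x • 1) :
    (∀ (α β : G) (x : A (α * β)),
        (Δ β⁻¹ α⁻¹ ((α * β)⁻¹) (mul_inv_rev α β).symm) ((S (α * β) (α * β)⁻¹ rfl) x)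
          = (TensorProduct.comm k (A α⁻¹) (A β⁻¹))
              ((TensorProduct.map (S α α⁻¹ rfl) (S β β⁻¹ rfl)) ((Δ α β (α * β) rfl) x)))
      ∧ (∀ x : A 1, ε ((S 1 1 inv_one) x) = ε x)
      ∧ (∀ (α : G) (a b : A α), (S α α⁻¹ rfl) (a * b) = (S α α⁻¹ rfl) b * (S α α⁻¹ rfl) a)
      ∧ (∀ α : G, (S α α⁻¹ rfl) (1 : A α) = 1) := by
  have coassoc (α β γ δ η ζ : G) (h₁ : α * β = δ) (h₂ : δ * γ = ζ) (h₃ : β * γ = η)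
      (h₄ : α * η = ζ) :
      (TensorProduct.assoc k (A α) (A β) (A γ)).toLinearMap ∘ₗ
          LinearMap.rTensor (A γ) (Δ α β δ h₁).toLinearMap ∘ₗ (Δ δ γ ζ h₂).toLinearMap
        = LinearMap.lTensor (A α) (Δ β γ η h₃).toLinearMap ∘ₗ (Δ α η ζ h₄).toLinearMap := by
    subst h₁ h₂ h₃
    ext x
    exact hcoassoc α β γ x
  have counit_right (α : G) : (TensorProduct.rid k (A α)).toLinearMap ∘ₗ
      LinearMap.lTensor (A α) ε.toLinearMap ∘ₗ (Δ α 1 α (mul_one α)).toLinearMap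
        = LinearMap.id :=
    LinearMap.ext (hcounit₁ α)
  have counit_left (α : G) : (TensorProduct.lid k (A α)).toLinearMap ∘ₗ
      LinearMap.rTensor (A α) ε.toLinearMap ∘ₗ (Δ 1 α α (one_mul α)).toLinearMap
        = LinearMap.id :=
    LinearMap.ext (hcounit₂ α)
  have antipode_left (α β : G) (h : α * β = 1) (h' : α⁻¹ = β) :
      conv (Δ α β 1 h).toLinearMap (S α β h') LinearMap.id
        = convUnit (A β) ε.toLinearMap := by
    obtain rfl : α = β⁻¹ := inv_eq_iff_eq_inv.mp h'
    ext x
    exact (hantipode₁ β x).trans (convUnit_apply ε.toLinearMap x).symm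
  have antipode_right (α β : G) (h : α * β = 1) (h' : β⁻¹ = α) :
      conv (Δ α β 1 h).toLinearMap LinearMap.id (S β α h')
        = convUnit (A α) ε.toLinearMap := by
    obtain rfl : β = α⁻¹ := inv_eq_iff_eq_inv.mp h'
    ext x
    exact (hantipode₂ α x).trans (convUnit_apply ε.toLinearMap x).symm
  refine ⟨fun α β => LinearMap.congr_fun (f := (Δ β⁻¹ α⁻¹ _ _).toLinearMap ∘ₗ S _ _ rfl)
    (g := (TensorProduct.comm k (A α⁻¹) (A β⁻¹)).toLinearMap ∘ₗ
      TensorProduct.map (S α α⁻¹ rfl) (S β β⁻¹ rfl) ∘ₗ (Δ α β (α * β) rfl).toLinearMap) ?_,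
    LinearMap.congr_fun (f := ε.toLinearMap ∘ₗ S 1 1 inv_one) (g := ε.toLinearMap) ?_,
    fun α a b => ?_, fun α => ?_⟩
  · let D := Δ β⁻¹ α⁻¹ (α * β)⁻¹ (mul_inv_rev α β).symm
    let i₁ : A β⁻¹ →ₐ[k] A β⁻¹ ⊗[k] A α⁻¹ := Algebra.TensorProduct.includeLeft
    let i₂ : A α⁻¹ →ₐ[k] A β⁻¹ ⊗[k] A α⁻¹ := Algebra.TensorProduct.includeRight
    have hD : D.toLinearMap = conv D.toLinearMap i₁.toLinearMap i₂.toLinearMap := by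
      have : LinearMap.mul' k _ ∘ₗ TensorProduct.map i₁.toLinearMap i₂.toLinearMap
          = LinearMap.id :=
        TensorProduct.ext' fun x y => by simp [i₁, i₂]
      exact congrArg (· ∘ₗ D.toLinearMap) this.symm
    have hG : (TensorProduct.comm k (A α⁻¹) (A β⁻¹)).toLinearMap ∘ₗ
        TensorProduct.map (S α α⁻¹ rfl) (S β β⁻¹ rfl) ∘ₗ (Δ α β (α * β) rfl).toLinearMap
        = conv (Δ α β (α * β) rfl).toLinearMap (i₂.toLinearMap ∘ₗ S α α⁻¹ rfl)
          (i₁.toLinearMap ∘ₗ S β β⁻¹ rfl) := by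
      have : (TensorProduct.comm k (A α⁻¹) (A β⁻¹)).toLinearMap ∘ₗ
          TensorProduct.map (S α α⁻¹ rfl) (S β β⁻¹ rfl)
          = LinearMap.mul' k _ ∘ₗ TensorProduct.map (i₂.toLinearMap ∘ₗ S α α⁻¹ rfl)
            (i₁.toLinearMap ∘ₗ S β β⁻¹ rfl) :=
        TensorProduct.ext' fun x y => by simp [i₁, i₂]
      exact congrArg (· ∘ₗ (Δ α β (α * β) rfl).toLinearMap) this
    refine left_inverse_eq_right_inverse
      (coassoc (α * β) (α * β)⁻¹ (α * β) 1 1 (α * β) (mul_inv_cancel _) (one_mul _)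
        (inv_mul_cancel _) (mul_one _))
      (counit_left _) (counit_right _) (m := D.toLinearMap) ?_ ?_
    · have := congrArg (D.toLinearMap ∘ₗ ·)
        (antipode_left (α * β) (α * β)⁻¹ (mul_inv_cancel _) rfl)
      simpa only [comp_conv, comp_convUnit, LinearMap.comp_id] using this
    · have hα : conv (Δ α⁻¹ α 1 (inv_mul_cancel α)).toLinearMap i₂.toLinearMap
          (i₂.toLinearMap ∘ₗ S α α⁻¹ rfl) = convUnit _ ε.toLinearMap := by
        have := congrArg (i₂.toLinearMap ∘ₗ ·) (antipode_right α⁻¹ α (inv_mul_cancel α) rfl)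
        simpa only [comp_conv, comp_convUnit, LinearMap.comp_id] using this
      have hβ : conv (Δ β⁻¹ β 1 (inv_mul_cancel β)).toLinearMap i₁.toLinearMap
          (i₁.toLinearMap ∘ₗ S β β⁻¹ rfl) = convUnit _ ε.toLinearMap := by
        have := congrArg (i₁.toLinearMap ∘ₗ ·) (antipode_right β⁻¹ β (inv_mul_cancel β) rfl)
        simpa only [comp_conv, comp_convUnit, LinearMap.comp_id] using this
      rw [hG, hD, conv_assoc (coassoc β⁻¹ α⁻¹ (α * β) (α * β)⁻¹ β 1 _ (inv_mul_cancel _)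
          (inv_mul_cancel_left α β) (inv_mul_cancel β)),
        ← conv_assoc (coassoc α⁻¹ α β 1 (α * β) β (inv_mul_cancel α) (one_mul β) rfl
          (inv_mul_cancel_left α β)), hα, convUnit_conv (counit_left β), LinearMap.comp_id, hβ]
  · have h := congrArg (ε.toLinearMap ∘ₗ ·) (antipode_left 1 1 (mul_one 1) inv_one)
    have hε : convUnit k ε.toLinearMap = ε.toLinearMap := by
      ext x
      simp [convUnit_apply]
    simp only [comp_conv, comp_convUnit, LinearMap.comp_id] at h
    nth_rewrite 2 [← hε] at h
    rwa [conv_convUnit (counit_right 1), LinearMap.comp_id, hε] at h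
  · refine LinearMap.congr_fun (f := S α α⁻¹ rfl ∘ₗ LinearMap.mul' k (A α))
      (g := LinearMap.mul' k (A α⁻¹) ∘ₗ (TensorProduct.comm k _ _).toLinearMap ∘ₗ
        TensorProduct.map (S α α⁻¹ rfl) (S α α⁻¹ rfl)) ?_ (a ⊗ₜ[k] b)
    exact left_inverse_eq_right_inverse
      (squareComul_coassoc (coassoc α α⁻¹ α 1 1 α (mul_inv_cancel α) (one_mul α)
        (inv_mul_cancel α) (mul_one α)))
      (squareCounit_lid (counit_left α)) (squareCounit_rid (counit_right α))
      (conv_comp_mul (antipode_left α α⁻¹ (mul_inv_cancel α) rfl))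
      (conv_mul_comm_map (antipode_right α⁻¹ α (inv_mul_cancel α) rfl))
  · have h := LinearMap.congr_fun (antipode_left α α⁻¹ (mul_inv_cancel α) rfl) 1
    simpa [conv, convUnit_apply, Algebra.TensorProduct.one_def] using h
end

section
/- If (Γ, d) is a left covariant π-graded first order differential calculus over A, then there exists a family of k-linear maps Δ^l = {Δ^l_{α,β}: Γ_{αβ} → A_α ⊗ Γ_β}_{α,β∈π} such that: (1) Δ^l_{α,β}(a·ρ) = Δ_{α,β}(a)·Δ^l_{α,β}(ρ) and Δ^l_{α,β}(ρ·a) = Δ^l_{α,β}(ρ)·Δ_{α,β}(a) for all a ∈ A_{αβ} and ρ ∈ Γ_{αβ}; (2) (Δ_{α,β} ⊗ id) ∘ Δ^l_{αβ,γ} = (id ⊗ Δ^l_{β,γ}) ∘ Δ^l_{α,βγ} for all α,β,γ ∈ π; (3) (ε ⊗ id) ∘ Δ^l_{1,α} = id on Γ_α; (4) Δ^l_{α,β} ∘ d_{αβ} = (id ⊗ d_β) ∘ Δ_{α,β}. (Explicitly, Δ^l_{α,β}(Σ_k a_k·d_{αβ}(b_k)) = Σ_k Δ_{α,β}(a_k)·(id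 ⊗ d_β)(Δ_{α,β}(b_k)) is well defined.) -/
open TensorProduct

/-- The componentwise action of `R ⊗[k] S` on `M ⊗[k] N` induced by `k`-bilinear
actions `f` of `R` on `M` and `g` of `S` on `N`: `(r ⊗ s) • (m ⊗ n) = (f r m) ⊗ (g s n)`. -/
noncomputable def tact {k : Type} [Field k] {R S M N : Type}
    [AddCommGroup R] [Module k R] [AddCommGroup S] [Module k S]
    [AddCommGroup M] [Module k M] [AddCommGroup N] [Module k N]
    (f : R →ₗ[k] M →ₗ[k] M) (g : S →ₗ[k] N →ₗ[k] N) :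
    R ⊗[k] S →ₗ[k] (M ⊗[k] N) →ₗ[k] M ⊗[k] N :=
  TensorProduct.lift (LinearMap.mk₂ k (fun r s => TensorProduct.map (f r) (g s))
    (fun r r' s => by simp only [map_add, TensorProduct.map_add_left])
    (fun c r s => by simp only [map_smul, TensorProduct.map_smul_left])
    (fun r s s' => by simp only [map_add, TensorProduct.map_add_right])
    (fun r c s => by simp only [map_smul, TensorProduct.map_smul_right]))

namespace TensorProduct

variable {k : Type} [Field k]

section tact

variable {R S M N R' S' M' N' : Type}
  [AddCommGroup R] [Module k R] [AddCommGroup S] [Module k S]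
  [AddCommGroup M] [Module k M] [AddCommGroup N] [Module k N]
  [AddCommGroup R'] [Module k R'] [AddCommGroup S'] [Module k S']
  [AddCommGroup M'] [Module k M'] [AddCommGroup N'] [Module k N']

theorem tact_tmul (f : R →ₗ[k] M →ₗ[k] M) (g : S →ₗ[k] N →ₗ[k] N) (r : R) (s : S)
    (m : M) (n : N) : tact f g (r ⊗ₜ s) (m ⊗ₜ n) = f r m ⊗ₜ g s n := rfl

theorem map_tact (f : R →ₗ[k] M →ₗ[k] M) (g : S →ₗ[k] N →ₗ[k] N)
    (f' : R' →ₗ[k] M' →ₗ[k] M') (g' : S' →ₗ[k] N' →ₗ[k] N')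
    (φ : R →ₗ[k] R') (ψ : S →ₗ[k] S') (u : M →ₗ[k] M') (v : N →ₗ[k] N')
    (hu : ∀ r m, u (f r m) = f' (φ r) (u m)) (hv : ∀ s n, v (g s n) = g' (ψ s) (v n))
    (x : R ⊗[k] S) (m : M ⊗[k] N) :
    map u v (tact f g x m) = tact f' g' (map φ ψ x) (map u v m) := by
  induction x with
  | zero => simp
  | add x y hx hy => simp only [map_add, LinearMap.add_apply, hx, hy]
  | tmul r s =>
    induction m with
    | zero => simp
    | add m n hm hn => simp only [map_add, hm, hn]
    | tmul m n => simp only [tact_tmul, map_tmul, hu, hv]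

theorem assoc_tact {T L : Type} [AddCommGroup T] [Module k T] [AddCommGroup L] [Module k L]
    (f : R →ₗ[k] M →ₗ[k] M) (g : S →ₗ[k] N →ₗ[k] N) (h : T →ₗ[k] L →ₗ[k] L)
    (x : (R ⊗[k] S) ⊗[k] T) (m : (M ⊗[k] N) ⊗[k] L) :
    TensorProduct.assoc k M N L (tact (tact f g) h x m)
      = tact f (tact g h) (TensorProduct.assoc k R S T x) (TensorProduct.assoc k M N L m) := by
  induction x with
  | zero => simp
  | add x y hx hy => simp only [map_add, LinearMap.add_apply, hx, hy]
  | tmul x t =>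
    induction x with
    | zero => simp
    | add x y hx hy => simp only [add_tmul, map_add, LinearMap.add_apply, hx, hy]
    | tmul r s =>
      induction m with
      | zero => simp
      | add m n hm hn => simp only [map_add, hm, hn]
      | tmul m l =>
        induction m with
        | zero => simp
        | add m n hm hn => simp only [add_tmul, map_add, hm, hn]
        | tmul m n => simp only [tact_tmul, assoc_tmul]

theorem lid_tact (g : S →ₗ[k] N →ₗ[k] N) (x : k ⊗[k] S) (m : k ⊗[k] N) :
    TensorProduct.lid k N (tact (LinearMap.mul k k) g x m)
      = g (TensorProduct.lid k S x) (TensorProduct.lid k N m) := by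
  induction x with
  | zero => simp
  | add x y hx hy => simp only [map_add, LinearMap.add_apply, hx, hy]
  | tmul r s =>
    induction m with
    | zero => simp
    | add m n hm hn => simp only [map_add, hm, hn]
    | tmul m n => simp [tact_tmul, mul_smul, smul_comm r m]

theorem tact_commute (f f' : R →ₗ[k] M →ₗ[k] M) (g g' : S →ₗ[k] N →ₗ[k] N)
    (hf : ∀ r r' m, f r (f' r' m) = f' r' (f r m))
    (hg : ∀ s s' n, g s (g' s' n) = g' s' (g s n)) (x y : R ⊗[k] S) (m : M ⊗[k] N) :
    tact f g x (tact f' g' y m) = tact f' g' y (tact f g x m) := by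
  induction x with
  | zero => simp
  | add x x' hx hx' => simp only [map_add, LinearMap.add_apply, hx, hx']
  | tmul r s =>
    induction y with
    | zero => simp
    | add y y' hy hy' => simp only [map_add, LinearMap.add_apply, hy, hy']
    | tmul r' s' =>
      induction m with
      | zero => simp
      | add m n hm hn => simp only [map_add, hm, hn]
      | tmul m n => simp only [tact_tmul, hf, hg]

end tact

section algebra

variable {R S M N : Type} [Ring R] [Algebra k R] [Ring S] [Algebra k S]
  [AddCommGroup M] [Module k M] [AddCommGroup N] [Module k N]

theorem tact_one (f : R →ₗ[k] M →ₗ[k] M) (g : S →ₗ[k] N →ₗ[k] N)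
    (hf : ∀ m, f 1 m = m) (hg : ∀ n, g 1 n = n) (m : M ⊗[k] N) : tact f g 1 m = m := by
  induction m with
  | zero => simp
  | add m n hm hn => simp only [map_add, hm, hn]
  | tmul m n => rw [Algebra.TensorProduct.one_def, tact_tmul, hf, hg]

theorem tact_mul (f : R →ₗ[k] M →ₗ[k] M) (g : S →ₗ[k] N →ₗ[k] N)
    (hf : ∀ a b m, f (a * b) m = f a (f b m)) (hg : ∀ a b n, g (a * b) n = g a (g b n))
    (x y : R ⊗[k] S) (m : M ⊗[k] N) : tact f g (x * y) m = tact f g x (tact f g y m) := by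
  induction x with
  | zero => simp
  | add x x' hx hx' => simp only [add_mul, map_add, LinearMap.add_apply, hx, hx']
  | tmul r s =>
    induction y with
    | zero => simp
    | add y y' hy hy' => simp only [mul_add, map_add, LinearMap.add_apply, hy, hy']
    | tmul r' s' =>
      induction m with
      | zero => simp
      | add m n hm hn => simp only [map_add, hm, hn]
      | tmul m n => simp only [Algebra.TensorProduct.tmul_mul_tmul, tact_tmul, hf, hg]

theorem tact_mul_mul :
    tact (LinearMap.mul k R) (LinearMap.mul k S) = LinearMap.mul k (R ⊗[k] S) := by
  ext
  simp [tact_tmul]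

/-- If `d` satisfies the Leibniz rule, then so does `id ⊗ d`. -/
theorem lTensor_leibniz (l r : S →ₗ[k] N →ₗ[k] N) (d : S →ₗ[k] N)
    (hd : ∀ a b, d (a * b) = r b (d a) + l a (d b)) (x y : R ⊗[k] S) :
    d.lTensor R (x * y) = tact (LinearMap.mul k R).flip r y (d.lTensor R x)
      + tact (LinearMap.mul k R) l x (d.lTensor R y) := by
  induction x with
  | zero => simp
  | add x x' hx hx' =>
    simp only [add_mul, map_add, LinearMap.add_apply, hx, hx']
    abel
  | tmul a s =>
    induction y with
    | zero => simp
    | add y y' hy hy' =>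
      simp only [mul_add, map_add, LinearMap.add_apply, hy, hy']
      abel
    | tmul a' s' =>
      simp only [Algebra.TensorProduct.tmul_mul_tmul, LinearMap.lTensor_tmul, tact_tmul, hd,
        tmul_add, LinearMap.flip_apply, LinearMap.mul_apply']

end algebra

theorem exists_fin_sum_tmul {M N : Type} [AddCommGroup M] [Module k M] [AddCommGroup N]
    [Module k N] (x : M ⊗[k] N) :
    ∃ (n : ℕ) (a : Fin n → M) (b : Fin n → N), x = ∑ i, a i ⊗ₜ[k] b i := by
  induction x with
  | zero => exact ⟨0, Fin.elim0, Fin.elim0, by simp⟩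
  | tmul a b => exact ⟨1, fun _ => a, fun _ => b, by simp⟩
  | add x y hx hy =>
    obtain ⟨n, a, b, rfl⟩ := hx
    obtain ⟨m, a', b', rfl⟩ := hy
    exact ⟨n + m, Fin.append a a', Fin.append b b', by simp [Fin.sum_univ_add]⟩

end TensorProduct

namespace LinearMap

variable {k : Type} [Field k] {A M N : Type} [AddCommGroup A] [Module k A]
  [AddCommGroup M] [Module k M] [AddCommGroup N] [Module k N]

theorem ext_of_span_bilin {B : A →ₗ[k] A →ₗ[k] M}
    (hB : ∀ x, x ∈ Submodule.span k {y : M | ∃ a b, y = B a b}) {u v : M →ₗ[k] N}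
    (h : ∀ a b, u (B a b) = v (B a b)) : u = v := by
  ext x
  refine LinearMap.eqOn_span ?_ (hB x)
  rintro _ ⟨a, b, rfl⟩
  exact h a b

/-- A bilinear map `C` factors through a bilinear map `B` with spanning image as soon as every
relation among the values of `B` holds among those of `C`. -/
theorem exists_factor_bilin (B : A →ₗ[k] A →ₗ[k] M) (C : A →ₗ[k] A →ₗ[k] N)
    (hBC : ∀ (n : ℕ) (a b : Fin n → A), ∑ i, B (a i) (b i) = 0 → ∑ i, C (a i) (b i) = 0) :
    ∃ D : M →ₗ[k] N, ∀ a b, D (B a b) = C a b := by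
  have hker : ker (TensorProduct.lift B) ≤ ker (TensorProduct.lift C) := by
    intro x hx
    obtain ⟨n, a, b, rfl⟩ := TensorProduct.exists_fin_sum_tmul x
    simp only [mem_ker, map_sum, TensorProduct.lift.tmul] at hx ⊢
    exact hBC n a b hx
  obtain ⟨D, hD⟩ := exists_extend (((ker (TensorProduct.lift B)).liftQ _ hker).comp
    (TensorProduct.lift B).quotKerEquivRange.symm.toLinearMap)
  refine ⟨D, fun a b => ?_⟩
  have := LinearMap.congr_fun hD ⟨TensorProduct.lift B (a ⊗ₜ b), mem_range_self _ _⟩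
  rw [comp_apply, comp_apply, LinearEquiv.coe_coe, quotKerEquivRange_symm_apply_image,
    Submodule.mkQ_apply, Submodule.liftQ_apply] at this
  simpa using this

end LinearMap

/-- A left covariant `π`-graded first order differential calculus `(Γ, d)`
over a Hopf `π`-coalgebra `A` admits a family of linear maps
`Δˡ_{α,β} : Γ_{αβ} → A_α ⊗ Γ_β` compatible with the bimodule structures, coassociative,
counital, and satisfying `Δˡ_{α,β} ∘ d_{αβ} = (id ⊗ d_β) ∘ Δ_{α,β}`. -/
theorem left_covariant_fodc_exists_left_coaction
    {k : Type} [Field k] {G : Type} [Group G]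
    (A : G → Type) [∀ α, Ring (A α)] [∀ α, Algebra k (A α)]
    (Δ : ∀ α β γ : G, α * β = γ → (A γ →ₐ[k] A α ⊗[k] A β))
    (ε : A 1 →ₐ[k] k)
    (S : ∀ α β : G, α⁻¹ = β → (A α →ₗ[k] A β))
    (hcoassoc : ∀ (α β γ : G) (x : A (α * β * γ)),
      (TensorProduct.assoc k (A α) (A β) (A γ))
          ((Algebra.TensorProduct.map (Δ α β (α * β) rfl) (AlgHom.id k (A γ)))
            ((Δ (α * β) γ (α * β * γ) rfl) x))
        = (Algebra.TensorProduct.map (AlgHom.id k (A α)) (Δ β γ (β * γ) rfl))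
            ((Δ α (β * γ) (α * β * γ) (mul_assoc α β γ).symm) x))
    (hcounit₁ : ∀ (α : G) (x : A α),
      (TensorProduct.rid k (A α)) ((LinearMap.lTensor (A α) ε.toLinearMap)
        ((Δ α 1 α (mul_one α)) x)) = x)
    (hcounit₂ : ∀ (α : G) (x : A α),
      (TensorProduct.lid k (A α)) ((LinearMap.rTensor (A α) ε.toLinearMap)
        ((Δ 1 α α (one_mul α)) x)) = x)
    (hantipode₁ : ∀ (α : G) (x : A 1),
      (LinearMap.mul' k (A α)) ((LinearMap.rTensor (A α) (S α⁻¹ α (inv_inv α)))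
        ((Δ α⁻¹ α 1 (inv_mul_cancel α)) x)) = ε x • 1)
    (hantipode₂ : ∀ (α : G) (x : A 1),
      (LinearMap.mul' k (A α)) ((LinearMap.lTensor (A α) (S α⁻¹ α (inv_inv α)))
        ((Δ α α⁻¹ 1 (mul_inv_cancel α)) x)) = ε x • 1)
    (Γ : G → Type) [∀ α, AddCommGroup (Γ α)] [∀ α, Module k (Γ α)]
    (sl sr : ∀ α, A α →ₗ[k] Γ α →ₗ[k] Γ α)
    (hsl_one : ∀ (α : G) (x : Γ α), sl α 1 x = x)
    (hsl_mul : ∀ (α : G) (a b : A α) (x : Γ α), sl α (a * b) x = sl α a (sl α b x))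
    (hsr_one : ∀ (α : G) (x : Γ α), sr α 1 x = x)
    (hsr_mul : ∀ (α : G) (a b : A α) (x : Γ α), sr α (a * b) x = sr α b (sr α a x))
    (hslr : ∀ (α : G) (a b : A α) (x : Γ α), sl α a (sr α b x) = sr α b (sl α a x))
    (d : ∀ α, A α →ₗ[k] Γ α)
    (hLeibniz : ∀ (α : G) (a b : A α), d α (a * b) = sr α b (d α a) + sl α a (d α b))
    (hgen : ∀ (α : G) (x : Γ α),
      x ∈ Submodule.span k {y : Γ α | ∃ a b : A α, y = sl α a (d α b)})
    (hlcov : ∀ (α β : G) (n : ℕ) (a b : Fin n → A (α * β)),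
      (∑ i, sl (α * β) (a i) (d (α * β) (b i))) = 0 →
      (∑ i, tact (LinearMap.mul k (A α)) (sl β) ((Δ α β (α * β) rfl) (a i))
          ((LinearMap.lTensor (A α) (d β)) ((Δ α β (α * β) rfl) (b i)))) = 0) :
    ∃ Dl : ∀ α β γ : G, α * β = γ → (Γ γ →ₗ[k] A α ⊗[k] Γ β),
      (∀ (α β γ : G) (h : α * β = γ) (a : A γ) (ρ : Γ γ),
        Dl α β γ h (sl γ a ρ)
          = tact (LinearMap.mul k (A α)) (sl β) ((Δ α β γ h) a) (Dl α β γ h ρ))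
      ∧ (∀ (α β γ : G) (h : α * β = γ) (a : A γ) (ρ : Γ γ),
        Dl α β γ h (sr γ a ρ)
          = tact ((LinearMap.mul k (A α)).flip) (sr β) ((Δ α β γ h) a) (Dl α β γ h ρ))
      ∧ (∀ (α β γ : G) (ρ : Γ (α * β * γ)),
        (TensorProduct.assoc k (A α) (A β) (Γ γ))
            ((LinearMap.rTensor (Γ γ) (Δ α β (α * β) rfl).toLinearMap)
              (Dl (α * β) γ (α * β * γ) rfl ρ))
          = (LinearMap.lTensor (A α) (Dl β γ (β * γ) rfl))
              (Dl α (β * γ) (α * β * γ) (mul_assoc α β γ).symm ρ))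
      ∧ (∀ (α : G) (ρ : Γ α),
        (TensorProduct.lid k (Γ α))
          ((LinearMap.rTensor (Γ α) ε.toLinearMap) (Dl 1 α α (one_mul α) ρ)) = ρ)
      ∧ (∀ (α β γ : G) (h : α * β = γ) (a : A γ),
        Dl α β γ h (d γ a) = (LinearMap.lTensor (A α) (d β)) ((Δ α β γ h) a)) := by
  have hDl : ∀ α β γ : G, ∀ h : α * β = γ, ∃ D : Γ γ →ₗ[k] A α ⊗[k] Γ β, ∀ a b : A γ,
      D (sl γ a (d γ b)) = tact (LinearMap.mul k (A α)) (sl β) (Δ α β γ h a)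
        ((d β).lTensor (A α) (Δ α β γ h b)) := by
    rintro α β _ rfl
    exact LinearMap.exists_factor_bilin ((sl (α * β)).compl₂ (d (α * β)))
      ((tact (LinearMap.mul k (A α)) (sl β)).compl₁₂ (Δ α β (α * β) rfl).toLinearMap
        ((d β).lTensor (A α) ∘ₗ (Δ α β (α * β) rfl).toLinearMap)) (hlcov α β)
  choose Dl hDl using hDl
  have hext : ∀ (γ : G) {N : Type} [AddCommGroup N] [Module k N] (u v : Γ γ →ₗ[k] N),
      (∀ a b, u (sl γ a (d γ b)) = v (sl γ a (d γ b))) → ∀ ρ, u ρ = v ρ := fun γ _ _ _ u v h =>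
    LinearMap.congr_fun
      (LinearMap.ext_of_span_bilin (B := (sl γ).compl₂ (d γ)) (hgen γ) h)
  have hmul : ∀ (α β : G) (x y : A α ⊗[k] A β) (m : A α ⊗[k] Γ β),
      tact (LinearMap.mul k (A α)) (sl β) (x * y) m
        = tact (LinearMap.mul k (A α)) (sl β) x (tact (LinearMap.mul k (A α)) (sl β) y m) :=
    fun α β => tact_mul _ _ (by simp [mul_assoc]) (hsl_mul β)
  have hleft : ∀ (α β γ : G) (h : α * β = γ) (a : A γ) (ρ : Γ γ),
      Dl α β γ h (sl γ a ρ)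
        = tact (LinearMap.mul k (A α)) (sl β) (Δ α β γ h a) (Dl α β γ h ρ) := by
    intro α β γ h a
    refine hext γ (Dl α β γ h ∘ₗ sl γ a)
      (tact (LinearMap.mul k (A α)) (sl β) (Δ α β γ h a) ∘ₗ Dl α β γ h) fun b c => ?_
    simp only [LinearMap.comp_apply]
    rw [← hsl_mul, hDl, hDl, map_mul, hmul]
  have hd : ∀ (α β γ : G) (h : α * β = γ) (a : A γ),
      Dl α β γ h (d γ a) = (d β).lTensor (A α) (Δ α β γ h a) := by
    intro α β γ h a
    rw [← hsl_one γ (d γ a), hDl, map_one, tact_one _ _ (by simp) (hsl_one β)]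
  refine ⟨Dl, hleft, ?_, ?_, ?_, hd⟩
  · intro α β γ h a
    refine hext γ (Dl α β γ h ∘ₗ sr γ a)
      (tact (LinearMap.mul k (A α)).flip (sr β) (Δ α β γ h a) ∘ₗ Dl α β γ h) fun b c => ?_
    simp only [LinearMap.comp_apply]
    have hcomm := tact_commute (LinearMap.mul k (A α)) (LinearMap.mul k (A α)).flip (sl β) (sr β)
      (by simp [mul_assoc]) (hslr β)
    rw [← hslr, eq_sub_of_add_eq (hLeibniz γ c a).symm, hleft, hleft, map_sub, hleft, hd, hd, hd,
      map_mul, lTensor_leibniz (sl β) (sr β) (d β) (hLeibniz β), add_sub_cancel_right, hcomm]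
  · intro α β γ
    refine hext _ ((TensorProduct.assoc k (A α) (A β) (Γ γ)).toLinearMap ∘ₗ
        (Δ α β (α * β) rfl).toLinearMap.rTensor (Γ γ) ∘ₗ Dl (α * β) γ (α * β * γ) rfl)
      ((Dl β γ (β * γ) rfl).lTensor (A α) ∘ₗ
        Dl α (β * γ) (α * β * γ) (mul_assoc α β γ).symm) fun a b => ?_
    simp only [LinearMap.comp_apply, LinearEquiv.coe_coe]
    have hd_assoc : ∀ y : A (α * β) ⊗[k] A γ,
        TensorProduct.assoc k (A α) (A β) (Γ γ) ((Δ α β (α * β) rfl).toLinearMap.rTensor (Γ γ)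
          ((d γ).lTensor (A (α * β)) y))
        = ((d γ).lTensor (A β)).lTensor (A α) (TensorProduct.assoc k (A α) (A β) (A γ)
          (map (Δ α β (α * β) rfl).toLinearMap LinearMap.id y)) := by
      intro y
      induction y with
      | zero => simp
      | add y y' hy hy' => simp only [map_add, hy, hy']
      | tmul p q =>
        simp only [LinearMap.lTensor_tmul, LinearMap.rTensor_tmul, map_tmul, LinearMap.id_apply]
        generalize (Δ α β (α * β) rfl).toLinearMap p = z
        induction z with
        | zero => simp
        | add y y' hy hy' => simp only [add_tmul, map_add, hy, hy']
        | tmul p q => simp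
    have hd_lTensor : ∀ y : A α ⊗[k] A (β * γ),
        (Dl β γ (β * γ) rfl).lTensor (A α) ((d (β * γ)).lTensor (A α) y)
        = ((d γ).lTensor (A β)).lTensor (A α)
          (map LinearMap.id (Δ β γ (β * γ) rfl).toLinearMap y) := by
      intro y
      induction y with
      | zero => simp
      | add y y' hy hy' => simp only [map_add, hy, hy']
      | tmul p q => simp [hd]
    have hco : ∀ x : A (α * β * γ), TensorProduct.assoc k (A α) (A β) (A γ)
          (map (Δ α β (α * β) rfl).toLinearMap LinearMap.id (Δ (α * β) γ (α * β * γ) rfl x))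
        = map LinearMap.id (Δ β γ (β * γ) rfl).toLinearMap
          (Δ α (β * γ) (α * β * γ) (mul_assoc α β γ).symm x) := hcoassoc α β γ
    have hr := map_tact (LinearMap.mul k (A (α * β))) (sl γ)
      (tact (LinearMap.mul k (A α)) (LinearMap.mul k (A β))) (sl γ)
      (Δ α β (α * β) rfl).toLinearMap LinearMap.id (Δ α β (α * β) rfl).toLinearMap LinearMap.id
      (by simp [tact_mul_mul]) (by simp)
    have hl := map_tact (LinearMap.mul k (A α)) (sl (β * γ)) (LinearMap.mul k (A α))
      (tact (LinearMap.mul k (A β)) (sl γ)) LinearMap.id (Δ β γ (β * γ) rfl).toLinearMap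
      LinearMap.id (Dl β γ (β * γ) rfl) (by simp) (hleft β γ (β * γ) rfl)
    rw [hDl, hDl]
    refine Eq.trans ?_ (hl _ _).symm
    rw [LinearMap.rTensor, hr, assoc_tact, hco, ← LinearMap.rTensor, hd_assoc, hco]
    exact congrArg _ (hd_lTensor _).symm
  · intro α
    refine hext α ((TensorProduct.lid k (Γ α)).toLinearMap ∘ₗ ε.toLinearMap.rTensor (Γ α) ∘ₗ
      Dl 1 α α (one_mul α)) LinearMap.id fun a b => ?_
    simp only [LinearMap.comp_apply, LinearEquiv.coe_coe, LinearMap.id_apply]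
    have hε := map_tact (LinearMap.mul k (A 1)) (sl α) (LinearMap.mul k k) (sl α)
      ε.toLinearMap LinearMap.id ε.toLinearMap LinearMap.id (by simp) (by simp)
    have hd_counit : ∀ y : A 1 ⊗[k] A α,
        TensorProduct.lid k (Γ α) (ε.toLinearMap.rTensor (Γ α) ((d α).lTensor (A 1) y))
        = d α (TensorProduct.lid k (A α) (ε.toLinearMap.rTensor (A α) y)) := by
      intro y
      induction y with
      | zero => simp
      | add y y' hy hy' => simp only [map_add, hy, hy']
      | tmul p q => simp
    rw [hDl, LinearMap.rTensor, hε, lid_tact, ← LinearMap.rTensor, ← LinearMap.rTensor,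
      hd_counit, hcounit₂, hcounit₂]
end

section
/- Let (Γ, Δ^l) be a left covariant π-graded bimodule over A. Then for all α, β ∈ π and every left invariant element ρ ∈ invΓ_{αβ}, there exists a left invariant element ϱ ∈ invΓ_β such that Δ^l_{α,β}(ρ) = 1_α ⊗ ϱ. -/
open TensorProduct

/-- In a left covariant `π`-graded bimodule over a Hopf `π`-coalgebra,
the image under `Δˡ_{α,β}` of a left invariant element `ρ ∈ Γ_{αβ}` has the form
`1_α ⊗ ϱ` for some left invariant `ϱ ∈ Γ_β`. -/
theorem left_coaction_of_left_invariant_element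
    {k : Type} [Field k] {G : Type} [Group G]
    (A : G → Type) [∀ α, Ring (A α)] [∀ α, Algebra k (A α)]
    (Δ : ∀ α β γ : G, α * β = γ → (A γ →ₐ[k] A α ⊗[k] A β))
    (ε : A 1 →ₐ[k] k)
    (S : ∀ α β : G, α⁻¹ = β → (A α →ₗ[k] A β))
    (hcoassoc : ∀ (α β γ : G) (x : A (α * β * γ)),
      (TensorProduct.assoc k (A α) (A β) (A γ))
          ((Algebra.TensorProduct.map (Δ α β (α * β) rfl) (AlgHom.id k (A γ)))
            ((Δ (α * β) γ (α * β * γ) rfl) x))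
        = (Algebra.TensorProduct.map (AlgHom.id k (A α)) (Δ β γ (β * γ) rfl))
            ((Δ α (β * γ) (α * β * γ) (mul_assoc α β γ).symm) x))
    (hcounit₁ : ∀ (α : G) (x : A α),
      (TensorProduct.rid k (A α)) ((LinearMap.lTensor (A α) ε.toLinearMap)
        ((Δ α 1 α (mul_one α)) x)) = x)
    (hcounit₂ : ∀ (α : G) (x : A α),
      (TensorProduct.lid k (A α)) ((LinearMap.rTensor (A α) ε.toLinearMap)
        ((Δ 1 α α (one_mul α)) x)) = x)
    (hantipode₁ : ∀ (α : G) (x : A 1),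
      (LinearMap.mul' k (A α)) ((LinearMap.rTensor (A α) (S α⁻¹ α (inv_inv α)))
        ((Δ α⁻¹ α 1 (inv_mul_cancel α)) x)) = ε x • 1)
    (hantipode₂ : ∀ (α : G) (x : A 1),
      (LinearMap.mul' k (A α)) ((LinearMap.lTensor (A α) (S α⁻¹ α (inv_inv α)))
        ((Δ α α⁻¹ 1 (mul_inv_cancel α)) x)) = ε x • 1)
    (Γ : G → Type) [∀ α, AddCommGroup (Γ α)] [∀ α, Module k (Γ α)]
    (sl sr : ∀ α, A α →ₗ[k] Γ α →ₗ[k] Γ α)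
    (hsl_one : ∀ (α : G) (x : Γ α), sl α 1 x = x)
    (hsl_mul : ∀ (α : G) (a b : A α) (x : Γ α), sl α (a * b) x = sl α a (sl α b x))
    (hsr_one : ∀ (α : G) (x : Γ α), sr α 1 x = x)
    (hsr_mul : ∀ (α : G) (a b : A α) (x : Γ α), sr α (a * b) x = sr α b (sr α a x))
    (hslr : ∀ (α : G) (a b : A α) (x : Γ α), sl α a (sr α b x) = sr α b (sl α a x))
    (Dl : ∀ α β γ : G, α * β = γ → (Γ γ →ₗ[k] A α ⊗[k] Γ β))
    (hDl_sl : ∀ (α β γ : G) (h : α * β = γ) (a : A γ) (ρ : Γ γ),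
      Dl α β γ h (sl γ a ρ)
        = tact (LinearMap.mul k (A α)) (sl β) ((Δ α β γ h) a) (Dl α β γ h ρ))
    (hDl_sr : ∀ (α β γ : G) (h : α * β = γ) (a : A γ) (ρ : Γ γ),
      Dl α β γ h (sr γ a ρ)
        = tact ((LinearMap.mul k (A α)).flip) (sr β) ((Δ α β γ h) a) (Dl α β γ h ρ))
    (hDl_coassoc : ∀ (α β γ : G) (ρ : Γ (α * β * γ)),
      (TensorProduct.assoc k (A α) (A β) (Γ γ))
          ((LinearMap.rTensor (Γ γ) (Δ α β (α * β) rfl).toLinearMap)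
            (Dl (α * β) γ (α * β * γ) rfl ρ))
        = (LinearMap.lTensor (A α) (Dl β γ (β * γ) rfl))
            (Dl α (β * γ) (α * β * γ) (mul_assoc α β γ).symm ρ))
    (hDl_counit : ∀ (α : G) (ρ : Γ α),
      (TensorProduct.lid k (Γ α))
        ((LinearMap.rTensor (Γ α) ε.toLinearMap) (Dl 1 α α (one_mul α) ρ)) = ρ)
    (α β : G) (ρ : Γ (α * β))
    (hρ : Dl 1 (α * β) (α * β) (one_mul (α * β)) ρ = (1 : A 1) ⊗ₜ[k] ρ) :
    ∃ ϱ : Γ β,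
      Dl 1 β β (one_mul β) ϱ = (1 : A 1) ⊗ₜ[k] ϱ
      ∧ Dl α β (α * β) rfl ρ = (1 : A α) ⊗ₜ[k] ϱ := by
  have hco : ∀ (α β γ δ ζ η : G) (h₁ : α * β = δ) (h₂ : δ * γ = η) (h₃ : β * γ = ζ)
      (h₄ : α * ζ = η) (x : A η),
      TensorProduct.assoc k (A α) (A β) (A γ)
          ((Δ α β δ h₁).toLinearMap.rTensor (A γ) (Δ δ γ η h₂ x))
        = (Δ β γ ζ h₃).toLinearMap.lTensor (A α) (Δ α ζ η h₄ x) := by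
    intro α β γ δ ζ η h₁ h₂ h₃ h₄ x
    subst h₁ h₂ h₃
    exact hcoassoc α β γ x
  have hDco : ∀ (α β γ δ ζ η : G) (h₁ : α * β = δ) (h₂ : δ * γ = η) (h₃ : β * γ = ζ)
      (h₄ : α * ζ = η) (x : Γ η),
      TensorProduct.assoc k (A α) (A β) (Γ γ)
          ((Δ α β δ h₁).toLinearMap.rTensor (Γ γ) (Dl δ γ η h₂ x))
        = (Dl β γ ζ h₃).lTensor (A α) (Dl α ζ η h₄ x) := by
    intro α β γ δ ζ η h₁ h₂ h₃ h₄ x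
    subst h₁ h₂ h₃
    exact hDl_coassoc α β γ x
  rcases subsingleton_or_nontrivial (A α) with hA | hA
  · exact ⟨0, by simp, Subsingleton.elim _ _⟩
  obtain ⟨f, hf⟩ := Module.Projective.exists_dual_eq_one k (one_ne_zero (α := A α))
  obtain ⟨Ψ, hΨ₁, hΨ₂⟩ : ∃ Ψ : A 1 ⊗[k] A α →ₗ[k] A α,
      (∀ a, Ψ (Δ 1 α α (one_mul α) a) = a) ∧ ∀ a, Ψ (1 ⊗ₜ a) = f a • 1 := by
    let E := LinearMap.mul' k (A α) ∘ₗ (S α⁻¹ α (inv_inv α)).rTensor (A α)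
    have hE : (f ∘ₗ E) ∘ₗ (Δ α⁻¹ α 1 (inv_mul_cancel α)).toLinearMap = ε.toLinearMap := by
      ext x
      simpa [E, hf] using congrArg f (hantipode₁ α x)
    have hS : S α⁻¹ α (inv_inv α) 1 = 1 := by
      simpa [Algebra.TensorProduct.one_def] using hantipode₁ α 1
    refine ⟨(TensorProduct.rid k (A α)).toLinearMap ∘ₗ (f ∘ₗ E).lTensor (A α) ∘ₗ
      (TensorProduct.assoc k (A α) (A α⁻¹) (A α)).toLinearMap ∘ₗ
      (Δ α α⁻¹ 1 (mul_inv_cancel α)).toLinearMap.rTensor (A α), fun a => ?_, fun a => ?_⟩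
    · have h := hco α α⁻¹ α 1 1 α (mul_inv_cancel α) (one_mul α) (inv_mul_cancel α)
        (mul_one α) a
      simp only [LinearMap.comp_apply, LinearEquiv.coe_coe]
      rw [h, ← LinearMap.comp_apply, ← LinearMap.lTensor_comp, hE]
      exact hcounit₁ α a
    · simp [E, hS, Algebra.TensorProduct.one_def]
  have hX : Dl α β (α * β) rfl ρ =
      (1 : A α) ⊗ₜ[k] TensorProduct.lid k (Γ β) (f.rTensor (Γ β) (Dl α β (α * β) rfl ρ)) := by
    have h := hDco 1 α β α (α * β) (α * β) (one_mul α) rfl rfl (one_mul (α * β)) ρ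
    rw [hρ, LinearMap.lTensor_tmul, ← LinearEquiv.eq_symm_apply] at h
    generalize Dl α β (α * β) rfl ρ = X at h ⊢
    have h' := congrArg (Ψ.rTensor (Γ β)) h
    have hl : Ψ ∘ₗ (Δ 1 α α (one_mul α)).toLinearMap = LinearMap.id :=
      LinearMap.ext hΨ₁
    rw [← LinearMap.comp_apply, ← LinearMap.rTensor_comp, hl, LinearMap.rTensor_id,
      LinearMap.id_apply] at h'
    refine h'.trans ?_
    clear h h'
    induction X with
    | zero => simp
    | tmul a x => simp [hΨ₂, TensorProduct.smul_tmul]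
    | add x y hx hy => simp only [map_add, TensorProduct.tmul_add, hx, hy]
  generalize TensorProduct.lid k (Γ β) (f.rTensor (Γ β) (Dl α β (α * β) rfl ρ)) = ϱ at hX
  refine ⟨ϱ, ?_, hX⟩
  have h := hDco α 1 β α β (α * β) (mul_one α) rfl (one_mul β) rfl ρ
  rw [hX] at h
  simpa [hf, Algebra.TensorProduct.one_def] using
    (congrArg (fun z => TensorProduct.lid k _ (f.rTensor _ z)) h).symm
end
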